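/- Let β > 0, d > 0, λ ≥ 0, and w, s ∈ ℝ. Set ẽ = (β w² + (d/2)s)/(β w² + d/2) and τ = λ/(2β w² + d). Then the function e ↦ β(1 − e)² w² + λ|e| + (d/2)(e − s)² on ℝ has a unique global minimizer, equal to the soft-thresholding sign(ẽ)·max(|ẽ| − τ, 0). -/

import Mathlib

/-- The objective of the proximal problem of `2 τ |·|` grows at least quadratically away from the
soft-thresholding of `t`. -/
theorem soft_threshold_quadratic_growth {t τ : ℝ} (hτ : 0 ≤ τ) (e : ℝ) :
    let m : ℝ := Real.sign t * max (|t| - τ) 0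
    (m - t)^2 + 2 * τ * |m| + (e - m)^2 ≤ (e - t)^2 + 2 * τ * |e| := by
  intro m
  have he₁ := le_abs_self e
  have he₂ := neg_abs_le e
  rcases le_total |t| τ with h | h
  · have hm : m = 0 := by simp [m, h]
    obtain ⟨h₁, h₂⟩ := abs_le.mp h
    rw [hm, abs_zero]
    have : t * e ≤ τ * |e| := calc
      t * e ≤ |t| * |e| := (le_abs_self _).trans_eq (abs_mul t e)
      _ ≤ τ * |e| := by gcongr
    nlinarith
  · rcases lt_trichotomy t 0 with ht | ht | ht
    · rw [abs_of_neg ht] at h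
      have hm : m = t + τ := by
        simp only [m, Real.sign_of_neg ht, abs_of_neg ht, max_eq_left (sub_nonneg.mpr h)]
        ring
      rw [hm, abs_of_nonpos (by linarith : t + τ ≤ 0)]
      nlinarith [mul_le_mul_of_nonneg_left he₂ hτ]
    · have hτ₀ : τ = 0 := le_antisymm (by simpa [ht] using h) hτ
      simp [m, ht, hτ₀]
    · rw [abs_of_pos ht] at h
      have hm : m = t - τ := by
        simp only [m, Real.sign_of_pos ht, abs_of_pos ht, max_eq_left (sub_nonneg.mpr h), one_mul]
      rw [hm, abs_of_nonneg (by linarith : 0 ≤ t - τ)]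
      nlinarith [mul_le_mul_of_nonneg_left he₁ hτ]


/-- Closed form of the SL-PAM contour update for the D-MS functional.
For `β > 0`, `d > 0`, `λ ≥ 0`, `w, s ∈ ℝ`, with
`ẽ = (β w² + (d/2)s)/(β w² + d/2)` and `τ = λ/(2β w² + d)`, the function
`e ↦ β(1 − e)² w² + λ|e| + (d/2)(e − s)²` has a unique global minimizer, equal to
`sign(ẽ)·max(|ẽ| − τ, 0)`. -/
theorem dms_contour_update_closed_form (β d lam w s : ℝ)
    (hβ : 0 < β) (hd : 0 < d) (hlam : 0 ≤ lam) :
    let etil : ℝ := (β * w^2 + (d/2) * s) / (β * w^2 + d/2)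
    let τ : ℝ := lam / (2 * β * w^2 + d)
    let F : ℝ → ℝ := fun e => β * (1 - e)^2 * w^2 + lam * |e| + (d/2) * (e - s)^2
    let m : ℝ := Real.sign etil * max (|etil| - τ) 0
    (∀ e : ℝ, F m ≤ F e) ∧ (∀ e : ℝ, (∀ e' : ℝ, F e ≤ F e') → e = m) := by
  intro etil τ F m
  have hA : 0 < β * w^2 + d/2 := by positivity
  have hτ : 0 ≤ τ := by positivity
  have hetil : (β * w^2 + d/2) * etil = β * w^2 + (d/2) * s := mul_div_cancel₀ _ hA.ne'
  have hlam' : 2 * (β * w^2 + d/2) * τ = lam := by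
    have : 2 * β * w^2 + d ≠ 0 := by positivity
    simp only [τ]
    field_simp
  have hF (e : ℝ) : F e = (β * w^2 + d/2) * ((e - etil)^2 + 2 * τ * |e|)
      + (β * w^2 + (d/2) * s^2 - (β * w^2 + d/2) * etil^2) := by
    simp only [F]
    linear_combination 2 * e * hetil - |e| * hlam'
  have growth (e : ℝ) : F m + (β * w^2 + d/2) * (e - m)^2 ≤ F e := by
    have := mul_le_mul_of_nonneg_left (soft_threshold_quadratic_growth (t := etil) hτ e) hA.le
    rw [hF, hF]
    linarith
  refine ⟨fun e => ?_, fun e he => ?_⟩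
  · have : 0 ≤ (β * w^2 + d/2) * (e - m)^2 := by positivity
    linarith [growth e]
  · have h : (e - m)^2 ≤ 0 := nonpos_of_mul_nonpos_right (by linarith [growth e, he m]) hA
    exact sub_eq_zero.mp (pow_eq_zero_iff two_ne_zero |>.mp (le_antisymm h (sq_nonneg _)))
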